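/- arXiv:2602.09298 — 2 statements merged into one kernel-verified Lean document; each statement's English description precedes it below -/
import Mathlib

section
/- Let p be an odd prime, K a field of characteristic p, and a, b, c, d, e ∈ K. Then: (i) if b ≠ 0, I_p(a + d/b, b, c + d, −d, e) = I_p(a, b, c, d, e) − e^p·(d^p − d); and (ii) I_p(−b, a − b + e, d, 1 − c − d, e) = I_p(a, b, c, d, e) − e^p·(d^p − d). That is, both the Weyl group generator s₂ and the rotation π map the integral of motion I_p to I_p − t^p·(α₂^p − α₂). -/
open MvPolynomial

noncomputable section

/-- The polynomial ring `R = 𝔽_p[f, g, α₁, α₂, t]`, with the five indeterminates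
indexed by `0, 1, 2, 3, 4` respectively. -/
abbrev R (p : ℕ) := MvPolynomial (Fin 5) (ZMod p)

def fP (p : ℕ) : R p := X 0
def gP (p : ℕ) : R p := X 1
def a1P (p : ℕ) : R p := X 2
def a2P (p : ℕ) : R p := X 3
def tP (p : ℕ) : R p := X 4

/-- `h = f·g·(t·g − 1)·(t·f − 1) + α₁·(t·g − 1) − α₂·(t·f − 1)`. -/
def hP (p : ℕ) : R p :=
  fP p * gP p * (tP p * gP p - 1) * (tP p * fP p - 1)
    + a1P p * (tP p * gP p - 1) - a2P p * (tP p * fP p - 1)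

def A0 (p : ℕ) : Matrix (Fin 2) (Fin 2) (R p) :=
  !![-(a1P p) * gP p + fP p * gP p ^ 2 - tP p * fP p ^ 2 * gP p ^ 2, -(fP p * gP p);
     fP p * gP p * hP p - a1P p * a2P p, -(a2P p) * fP p - fP p ^ 2 * gP p + tP p * fP p ^ 2 * gP p ^ 2]

def A1 (p : ℕ) : Matrix (Fin 2) (Fin 2) (R p) := !![0, 1; hP p, 0]

def A2 (p : ℕ) : Matrix (Fin 2) (Fin 2) (R p) :=
  !![tP p, 0; 1 - tP p ^ 2 * fP p * gP p, -(tP p)]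

def A3 (p : ℕ) : Matrix (Fin 2) (Fin 2) (R p) := !![0, 0; -(tP p ^ 2), 0]

/-- The Lax coefficient matrix `A(z) = A₀ + z·A₁ + z²·A₂ + z³·A₃`, with entries in any
commutative ring `S` receiving a ring homomorphism from `R`. -/
def AM (p : ℕ) {S : Type*} [CommRing S] (φ : R p →+* S) (z : S) : Matrix (Fin 2) (Fin 2) S :=
  (A0 p).map φ + z • (A1 p).map φ + z ^ 2 • (A2 p).map φ + z ^ 3 • (A3 p).map φ

/-- The integral of motion `I_p = Tr[A(p−1)·A(p−2)·⋯·A(1)·A(0)] ∈ R`. -/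
def Ip (p : ℕ) : R p :=
  Matrix.trace (((List.range p).reverse.map (fun k => AM p (RingHom.id (R p)) (k : R p))).prod)

/-- Evaluation of a polynomial `P ∈ R` at a point `(a,b,c,d,e) ∈ K⁵` of a field (or
commutative ring) of characteristic `p`. -/
def evalP (p : ℕ) (P : R p) (K : Type*) [CommRing K] [CharP K p] (a b c d e : K) : K :=
  eval₂ (ZMod.castHom (dvd_refl p) K) ![a, b, c, d, e] P

end

open scoped Polynomial

/-- The ordered product `σⁿ⁻¹(M) ⋯ σ(M) M` of the translates of a matrix under an endomorphism. -/
def shiftProd {S : Type*} [CommRing S] (σ : S →+* S) (M : Matrix (Fin 2) (Fin 2) S) :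
    ℕ → Matrix (Fin 2) (Fin 2) S
  | 0 => 1
  | n + 1 => (σ ^ n).mapMatrix M * shiftProd σ M n

section ShiftProd

variable {S : Type*} [CommRing S] (σ : S →+* S) (M : Matrix (Fin 2) (Fin 2) S)

lemma mapMatrix_pow_add (m n : ℕ) :
    (σ ^ (m + n)).mapMatrix M = (σ ^ m).mapMatrix ((σ ^ n).mapMatrix M) := by
  ext i j
  simp [pow_add]

lemma shiftProd_add (m n : ℕ) :
    shiftProd σ M (m + n) = (σ ^ n).mapMatrix (shiftProd σ M m) * shiftProd σ M n := by
  induction m with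
  | zero => simp [shiftProd]
  | succ m ih =>
    rw [Nat.add_right_comm, shiftProd, ih, shiftProd, map_mul, ← mapMatrix_pow_add, add_comm n m,
      mul_assoc]

lemma mapMatrix_shiftProd {T : Type*} [CommRing T] (σ' : T →+* T) (φ : S →+* T)
    (h : φ.comp σ = σ'.comp φ) (n : ℕ) :
    φ.mapMatrix (shiftProd σ M n) = shiftProd σ' (φ.mapMatrix M) n := by
  have hpow : ∀ (k : ℕ) (x : S), φ ((σ ^ k) x) = (σ' ^ k) (φ x) := by
    intro k
    induction k with
    | zero => simp
    | succ k ih =>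
      intro x
      rw [pow_succ, pow_succ, RingHom.mul_def, RingHom.mul_def, RingHom.comp_apply,
        RingHom.comp_apply, ih, ← RingHom.comp_apply φ, h, RingHom.comp_apply]
  induction n with
  | zero => simp [shiftProd]
  | succ n ih =>
    rw [shiftProd, shiftProd, map_mul, ih]
    congr 1
    ext1 i j
    exact hpow n _

/-- Gauge equivalent matrices have gauge equivalent shifted products. -/
lemma gauge_shiftProd {M' G : Matrix (Fin 2) (Fin 2) S}
    (h : σ.mapMatrix G * M = M' * G) (n : ℕ) :
    (σ ^ n).mapMatrix G * shiftProd σ M n = shiftProd σ M' n * G := by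
  induction n with
  | zero => simp [shiftProd]
  | succ n ih =>
    have hn := congrArg (σ ^ n).mapMatrix h
    rw [map_mul, map_mul] at hn
    have hs : (σ ^ (n + 1)).mapMatrix G = (σ ^ n).mapMatrix (σ.mapMatrix G) := by
      rw [mapMatrix_pow_add, pow_one]
    rw [shiftProd, shiftProd, ← mul_assoc, hs, hn, mul_assoc, ih, mul_assoc]

lemma trace_shiftProd_of_gauge [IsDomain S] {M' G : Matrix (Fin 2) (Fin 2) S} {n : ℕ}
    (hσ : σ ^ n = 1) (h : σ.mapMatrix G * M = M' * G) (hG : G.det ≠ 0) :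
    (shiftProd σ M n).trace = (shiftProd σ M' n).trace := by
  have hg := gauge_shiftProd σ M h n
  have h1 : (1 : S →+* S).mapMatrix G = G := by ext i j; simp
  rw [hσ, h1] at hg
  apply mul_left_cancel₀ hG
  have hl : (G.adjugate * (G * shiftProd σ M n)).trace = G.det * (shiftProd σ M n).trace := by
    rw [← mul_assoc, Matrix.adjugate_mul, smul_mul_assoc, one_mul, Matrix.trace_smul, smul_eq_mul]
  have hr : (G.adjugate * (shiftProd σ M' n * G)).trace = G.det * (shiftProd σ M' n).trace := by
    rw [Matrix.trace_mul_comm, mul_assoc, Matrix.mul_adjugate, mul_smul_comm, mul_one,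
      Matrix.trace_smul, smul_eq_mul]
  rw [← hl, ← hr, hg]

lemma map_trace_shiftProd {n : ℕ} (hσ : σ ^ (n + 1) = 1) :
    σ (shiftProd σ M (n + 1)).trace = (shiftProd σ M (n + 1)).trace := by
  have h1 : (1 : S →+* S).mapMatrix M = M := by ext i j; simp
  have hmap : σ (shiftProd σ M (n + 1)).trace = (σ.mapMatrix (shiftProd σ M (n + 1))).trace :=
    AddMonoidHom.map_trace σ.toAddMonoidHom _
  have hM : σ.mapMatrix ((σ ^ n).mapMatrix M) = M := by
    have := mapMatrix_pow_add σ M 1 n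
    rwa [pow_one, add_comm 1 n, hσ, h1, eq_comm] at this
  have hcyc : shiftProd σ M (n + 1) = σ.mapMatrix (shiftProd σ M n) * M := by
    rw [shiftProd_add]
    simp [shiftProd]
  rw [hmap, shiftProd, map_mul, hM, Matrix.trace_mul_comm, ← hcyc, shiftProd]

end ShiftProd

section Marking

variable {A : Type*} [CommRing A] (σ : A[X] →+* A[X]) (M : Matrix (Fin 2) (Fin 2) A[X])

lemma map_derivative_mul (P Q : Matrix (Fin 2) (Fin 2) A[X]) :
    (P * Q).map Polynomial.derivative =
      P.map Polynomial.derivative * Q + P * Q.map Polynomial.derivative := by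
  ext1 i j
  simp [Matrix.mul_apply, Polynomial.derivative_mul]
  ring

lemma map_derivative_shiftProd
    (hσ : ∀ x, Polynomial.derivative (σ x) = σ (Polynomial.derivative x)) (n : ℕ) :
    (shiftProd σ M n).map Polynomial.derivative =
      ∑ i ∈ Finset.range n, (σ ^ (i + 1)).mapMatrix (shiftProd σ M (n - 1 - i)) *
        ((σ ^ i).mapMatrix (M.map Polynomial.derivative) * shiftProd σ M i) := by
  have hpow : ∀ (k : ℕ) (x : A[X]),
      Polynomial.derivative ((σ ^ k) x) = (σ ^ k) (Polynomial.derivative x) := by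
    intro k
    induction k with
    | zero => simp
    | succ k ih =>
      intro x
      rw [pow_succ, RingHom.mul_def, RingHom.comp_apply, RingHom.comp_apply, ih, hσ]
  induction n with
  | zero =>
    ext1 i j
    fin_cases i <;> fin_cases j <;> simp [shiftProd]
  | succ n ih =>
    have hM : ((σ ^ n).mapMatrix M).map Polynomial.derivative
        = (σ ^ n).mapMatrix (M.map Polynomial.derivative) := by
      ext1 i j
      exact hpow n _
    rw [shiftProd, map_derivative_mul, ih, hM, Finset.sum_range_succ, Finset.mul_sum]
    refine (add_comm _ _).trans (congrArg₂ (· + ·) ?_ ?_)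
    · refine Finset.sum_congr rfl fun i hi => ?_
      have hin : i < n := Finset.mem_range.mp hi
      obtain ⟨m, rfl⟩ : ∃ m, n = i + 1 + m := ⟨n - (i + 1), by omega⟩
      rw [show i + 1 + m - 1 - i = m by omega, show i + 1 + m + 1 - 1 - i = m + 1 by omega,
        shiftProd, map_mul, mapMatrix_pow_add]
      simp only [mul_assoc]
    · simp [shiftProd]

/-- The derivative of the trace of a full period is the sum of the translates of one term. -/
lemma derivative_trace_shiftProd
    (hσ : ∀ x, Polynomial.derivative (σ x) = σ (Polynomial.derivative x)) {n : ℕ}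
    (hn : σ ^ (n + 1) = 1) :
    Polynomial.derivative (shiftProd σ M (n + 1)).trace =
      ∑ i ∈ Finset.range (n + 1), (σ ^ i)
        (M.map Polynomial.derivative * σ.mapMatrix (shiftProd σ M n)).trace := by
  have h : Polynomial.derivative (shiftProd σ M (n + 1)).trace =
      ((shiftProd σ M (n + 1)).map Polynomial.derivative).trace :=
    AddMonoidHom.map_trace (Polynomial.derivative (R := A)).toAddMonoidHom _
  rw [h, map_derivative_shiftProd σ M hσ, Matrix.trace_sum]
  refine Finset.sum_congr rfl fun i hi => ?_
  have hin : i < n + 1 := Finset.mem_range.mp hi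
  obtain ⟨m, rfl⟩ : ∃ m, n = i + m := ⟨n - i, by omega⟩
  have hi1 : shiftProd σ M i = (σ ^ (i + 1)).mapMatrix ((σ ^ m).mapMatrix (shiftProd σ M i)) := by
    rw [← mapMatrix_pow_add, show i + 1 + m = i + m + 1 by omega, hn]
    ext i j
    simp
  have hmap : (σ ^ i) (M.map Polynomial.derivative * σ.mapMatrix (shiftProd σ M (i + m))).trace
      = ((σ ^ i).mapMatrix
          (M.map Polynomial.derivative * σ.mapMatrix (shiftProd σ M (i + m)))).trace :=
    AddMonoidHom.map_trace (σ ^ i).toAddMonoidHom _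
  have hs : (σ ^ i).mapMatrix (σ.mapMatrix (shiftProd σ M (i + m)))
      = (σ ^ (i + 1)).mapMatrix (shiftProd σ M (i + m)) := by
    rw [mapMatrix_pow_add, pow_one]
  rw [hmap, map_mul, hs, shiftProd_add, map_mul, ← hi1, Matrix.trace_mul_comm, mul_assoc,
    show i + m + 1 - 1 - i = m by omega]

end Marking

section HalfDegree

variable {K : Type*} [Field K]

/-- Every coefficient of `P ∈ K[X][Y]` has degree at most `d / 2` in the inner variable. -/
def HalfDegreeLE (d : ℤ) (P : K[X][X]) : Prop :=
  ∀ n k : ℕ, d < 2 * k → (P.coeff n).coeff k = 0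

lemma HalfDegreeLE.add {d : ℤ} {P Q : K[X][X]} (hP : HalfDegreeLE d P) (hQ : HalfDegreeLE d Q) :
    HalfDegreeLE d (P + Q) := by
  intro n k hk
  simp [hP n k hk, hQ n k hk]

lemma HalfDegreeLE.mono {d e : ℤ} {P : K[X][X]} (hP : HalfDegreeLE d P) (h : d ≤ e) :
    HalfDegreeLE e P :=
  fun n k hk => hP n k (h.trans_lt hk)

lemma HalfDegreeLE.mul {d e : ℤ} {P Q : K[X][X]} (hP : HalfDegreeLE d P)
    (hQ : HalfDegreeLE e Q) : HalfDegreeLE (d + e) (P * Q) := by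
  intro n k hk
  rw [Polynomial.coeff_mul, Polynomial.finsetSum_coeff]
  refine Finset.sum_eq_zero fun x _ => ?_
  rw [Polynomial.coeff_mul]
  refine Finset.sum_eq_zero fun y hy => ?_
  have hyk : y.1 + y.2 = k := Finset.HasAntidiagonal.mem_antidiagonal.mp hy
  by_cases h : d < 2 * y.1
  · rw [hP _ _ h, zero_mul]
  · rw [hQ _ _ (by push_cast [← hyk] at hk; linarith), mul_zero]

/-- The substitution `X ↦ X + c` as a ring endomorphism. -/
noncomputable def translateHom (c : K) : K[X] →+* K[X] := (Polynomial.taylorAlgHom c : K[X] →+* K[X])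

lemma translateHom_apply (c : K) (P : K[X]) : translateHom c P = Polynomial.taylor c P := rfl

lemma translateHom_one_pow (n : ℕ) : translateHom (1 : K) ^ n = translateHom (n : K) := by
  induction n with
  | zero => ext x <;> simp [translateHom_apply]
  | succ n ih =>
    rw [pow_succ, ih]
    ext1
    · ext1 x
      simp [translateHom_apply]
    · simp only [RingHom.mul_def, RingHom.comp_apply, translateHom_apply, Polynomial.taylor_X,
        map_add, Polynomial.taylor_C, Nat.cast_succ]
      ring

lemma translateHom_one_pow_char (p : ℕ) [CharP K p] : translateHom (1 : K) ^ p = 1 := by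
  rw [translateHom_one_pow]
  ext x <;> simp [translateHom_apply]

lemma mapRingHom_pow (σ : K[X] →+* K[X]) (n : ℕ) :
    Polynomial.mapRingHom σ ^ n = Polynomial.mapRingHom (σ ^ n) := by
  induction n with
  | zero => ext x <;> simp
  | succ n ih => rw [pow_succ, ih, pow_succ, RingHom.mul_def, Polynomial.mapRingHom_comp]; rfl

lemma HalfDegreeLE.translateHom {d : ℤ} {P : K[X][X]} (hP : HalfDegreeLE d P) (c : K) :
    HalfDegreeLE d (Polynomial.mapRingHom (translateHom c) P) := by
  intro n k hk
  have h0 : Polynomial.hasseDeriv k (P.coeff n) = 0 := by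
    ext m
    rw [Polynomial.hasseDeriv_coeff, hP n (m + k) (by push_cast; linarith)]
    simp
  rw [Polynomial.coe_mapRingHom, Polynomial.coeff_map, translateHom_apply, Polynomial.taylor_coeff,
    h0, Polynomial.eval_zero]

/-- The weights `0, 1` of the two rows. -/
def rowWeight (i : Fin 2) : ℤ := (i : ℕ)

lemma halfDegreeLE_shiftProd {M : Matrix (Fin 2) (Fin 2) K[X][X]}
    (hM : ∀ i j, HalfDegreeLE (3 + rowWeight i - rowWeight j) (M i j)) (n : ℕ) (i j : Fin 2) :
    HalfDegreeLE (3 * n + rowWeight i - rowWeight j)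
      (shiftProd (Polynomial.mapRingHom (translateHom 1)) M n i j) := by
  induction n generalizing i with
  | zero =>
    intro m k hk
    rcases eq_or_ne i j with rfl | hij
    · have hk0 : k ≠ 0 := by rintro rfl; simp at hk
      simp only [shiftProd, Matrix.one_apply_eq, Polynomial.coeff_one]
      split_ifs <;> simp [Polynomial.coeff_one, hk0]
    · simp [shiftProd, hij]
  | succ n ih =>
    rw [shiftProd, mapRingHom_pow, translateHom_one_pow, Matrix.mul_apply, Fin.sum_univ_two]
    refine HalfDegreeLE.add ?_ ?_
    · exact (((hM i 0).translateHom _).mul (ih 0)).mono (by push_cast; linarith)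
    · exact (((hM i 1).translateHom _).mul (ih 1)).mono (by push_cast; linarith)

lemma sum_range_pow_eq_zero (p : ℕ) [Fact p.Prime] [CharP K p] {n : ℕ} (hn : n < p - 1) :
    ∑ i ∈ Finset.range p, (i : K) ^ n = 0 := by
  have h := FiniteField.sum_pow_lt_card_sub_one (ZMod p) n (by rwa [ZMod.card])
  have h2 := congrArg (ZMod.castHom (dvd_refl p) K) h
  rw [map_sum, map_zero] at h2
  rw [← h2]
  refine Finset.sum_bij' (fun i _ => (i : ZMod p)) (fun x _ => x.val) ?_ ?_ ?_ ?_ ?_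
  · simp
  · intro x _
    exact Finset.mem_range.mpr (ZMod.val_lt x)
  · intro i hi
    exact ZMod.val_cast_of_lt (Finset.mem_range.mp hi)
  · simp
  · intro i _
    simp

/-- Summing a polynomial of degree less than `2p - 1` over its translates by the prime field
yields degree less than `p`. -/
lemma coeff_sum_translateHom_eq_zero (p : ℕ) [Fact p.Prime] [CharP K p] {W : K[X]}
    (hW : ∀ k, 2 * p - 1 ≤ k → W.coeff k = 0) {k : ℕ} (hk : p ≤ k) :
    (∑ i ∈ Finset.range p, translateHom (i : K) W).coeff k = 0 := by
  have hp : 2 ≤ p := (Fact.out : p.Prime).two_le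
  have hdeg : (Polynomial.hasseDeriv k W).natDegree < p - 1 := by
    refine Nat.lt_of_le_pred (by omega) (Polynomial.natDegree_le_iff_coeff_eq_zero.mpr
      fun m hm => ?_)
    rw [Nat.pred_eq_sub_one] at hm
    rw [Polynomial.hasseDeriv_coeff, hW _ (by omega), mul_zero]
  simp only [Polynomial.finsetSum_coeff, translateHom_apply, Polynomial.taylor_coeff,
    Polynomial.eval_eq_sum_range' hdeg]
  rw [Finset.sum_comm]
  refine Finset.sum_eq_zero fun m hm => ?_
  rw [← Finset.mul_sum, sum_range_pow_eq_zero p (Finset.mem_range.mp hm), mul_zero]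

end HalfDegree

section Lax

variable {K : Type*} [Field K]

/-- The evaluated Lax matrix as a polynomial matrix in the spectral variable. -/
noncomputable def laxPoly (a b c d e : K) : Matrix (Fin 2) (Fin 2) K[X] :=
  let u := a * b
  let h := u * (e * b - 1) * (e * a - 1) + c * (e * b - 1) - d * (e * a - 1)
  !![.C e * .X ^ 2 + .C (-c * b + u * b - e * u ^ 2), .X - .C u;
    -.C (e ^ 2) * .X ^ 3 + .C (1 - e ^ 2 * u) * .X ^ 2 + .C h * .X + .C (u * h - c * d),
    -.C e * .X ^ 2 + .C (-d * a - a * u + e * u ^ 2)]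

/-- A gauge equivalent form of the Lax matrix of lower degree. -/
noncomputable def reducedLax (a b c d e : K) : Matrix (Fin 2) (Fin 2) K[X] :=
  let u := a * b
  !![.C (b * (u - c)), .X - .C u;
    .X ^ 2 + .C (u + d - c) * .X + .C (e * b * (u - c) + u ^ 2 + (d - c) * u - c * d),
    .C e * .X + .C (-e * u - a * (u + d))]

lemma laxPoly_gauge (a b c d e : K) :
    (translateHom 1).mapMatrix !![1, 0; .C e * (.X + .C (a * b)), 1] * laxPoly a b c d e =
      reducedLax a b c d e * !![1, 0; .C e * (.X + .C (a * b)), 1] := by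
  ext1 i j
  fin_cases i <;> fin_cases j <;>
    simp [laxPoly, reducedLax, Matrix.mul_apply, translateHom_apply] <;> ring

/-- The trace of the shifted product of the reduced Lax matrix over a full period. -/
noncomputable def laxTrace (p : ℕ) (a b c d e : K) : K[X] :=
  (shiftProd (translateHom 1) (reducedLax a b c d e) p).trace

lemma trace_laxPoly (p : ℕ) [CharP K p] (a b c d e : K) :
    (shiftProd (translateHom 1) (laxPoly a b c d e) p).trace = laxTrace p a b c d e :=
  trace_shiftProd_of_gauge _ _ (translateHom_one_pow_char p) (laxPoly_gauge a b c d e)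
    (by simp [Matrix.det_fin_two])

lemma translateHom_comp_comm (c : K) :
    (translateHom c).comp (translateHom 1) = (translateHom 1).comp (translateHom c) := by
  ext1
  · ext1 x
    simp [translateHom_apply]
  · simp [translateHom_apply, add_right_comm]

lemma translateHom_laxTrace (p : ℕ) (a b c d e r : K) :
    translateHom r (laxTrace p a b c d e) =
      (shiftProd (translateHom 1) ((translateHom r).mapMatrix (reducedLax a b c d e)) p).trace := by
  rw [← mapMatrix_shiftProd (translateHom 1) _ (translateHom 1) _ (translateHom_comp_comm r)]
  exact AddMonoidHom.map_trace (translateHom r).toAddMonoidHom _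

lemma translateHom_laxTrace_reflection (p : ℕ) (a b c d e : K) (hb : b ≠ 0) :
    translateHom d (laxTrace p (a + d / b) b (c + d) (-d) e) = laxTrace p a b c d e := by
  rw [translateHom_laxTrace, laxTrace]
  congr 2
  have hu : (a + d / b) * b = a * b + d := by field_simp
  have hv : (a + d / b) * (a * b + d + -d) = a * (a * b + d) := by field_simp; ring
  ext1 i j
  fin_cases i <;> fin_cases j <;>
    simp only [reducedLax, hu, hv] <;> simp [translateHom_apply] <;> ring

lemma reducedLax_gauge_rotation (a b c d e : K) :
    (translateHom 1).mapMatrix !![.C (-b), 1; .X - .C (c + b * (e - b)), .C (e - b)] *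
        reducedLax a b c d e =
      (translateHom d).mapMatrix (reducedLax (-b) (a - b + e) d (1 - c - d) e) *
        !![.C (-b), 1; .X - .C (c + b * (e - b)), .C (e - b)] := by
  ext1 i j
  fin_cases i <;> fin_cases j <;>
    simp [reducedLax, Matrix.mul_apply, translateHom_apply] <;> ring

lemma translateHom_laxTrace_rotation (p : ℕ) [CharP K p] (a b c d e : K) :
    translateHom d (laxTrace p (-b) (a - b + e) d (1 - c - d) e) = laxTrace p a b c d e := by
  rw [translateHom_laxTrace, laxTrace]
  refine (trace_shiftProd_of_gauge _ _ (translateHom_one_pow_char p)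
    (reducedLax_gauge_rotation a b c d e) ?_).symm
  have hdet : Matrix.det !![.C (-b), 1; .X - .C (c + b * (e - b)), .C (e - b)] =
      -(.X - .C c : K[X]) := by
    simp [Matrix.det_fin_two]
    ring
  rw [hdet]
  exact neg_ne_zero.mpr (Polynomial.X_sub_C_ne_zero c)

end Lax

section LaxTrace

variable {K : Type*} [Field K]

/-- The matrix `B` with its second column multiplied by a marking variable. -/
noncomputable def markColumn (B : Matrix (Fin 2) (Fin 2) K[X]) : Matrix (Fin 2) (Fin 2) K[X][X] :=
  !![.C (B 0 0), .C (B 0 1) * .X; .C (B 1 0), .C (B 1 1) * .X]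

/-- The shifted product of a marked matrix. -/
noncomputable def markedProd (B : Matrix (Fin 2) (Fin 2) K[X]) (n : ℕ) :
    Matrix (Fin 2) (Fin 2) K[X][X] :=
  shiftProd (Polynomial.mapRingHom (translateHom 1)) (markColumn B) n

variable (B : Matrix (Fin 2) (Fin 2) K[X])

lemma markedProd_zero : markedProd B 0 = 1 := rfl

lemma markedProd_succ (n : ℕ) (i j : Fin 2) :
    markedProd B (n + 1) i j =
      .C (translateHom (n : K) (B i 0)) * markedProd B n 0 j +
        .C (translateHom (n : K) (B i 1)) * (.X * markedProd B n 1 j) := by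
  rw [markedProd, shiftProd, mapRingHom_pow, translateHom_one_pow, Matrix.mul_apply,
    Fin.sum_univ_two]
  fin_cases i <;> simp [markColumn, markedProd, mul_assoc]

lemma natDegree_markedProd_le (n : ℕ) (i j : Fin 2) : (markedProd B n i j).natDegree ≤ n := by
  induction n generalizing i with
  | zero =>
    rw [markedProd_zero, Matrix.one_apply]
    split_ifs <;> simp
  | succ n ih =>
    rw [markedProd_succ]
    refine Polynomial.natDegree_add_le_of_degree_le ?_ ?_
    · exact (Polynomial.natDegree_C_mul_le _ _).trans ((ih 0).trans n.le_succ)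
    · refine (Polynomial.natDegree_C_mul_le _ _).trans ?_
      refine Polynomial.natDegree_mul_le.trans ?_
      have := ih 1
      have := Polynomial.natDegree_X_le (R := K[X])
      omega

lemma coeff_succ_markedProd_succ (n : ℕ) (i j : Fin 2) :
    (markedProd B (n + 1) i j).coeff (n + 1) =
      translateHom (n : K) (B i 1) * (markedProd B n 1 j).coeff n := by
  rw [markedProd_succ, Polynomial.coeff_add, Polynomial.coeff_C_mul, Polynomial.coeff_C_mul,
    Polynomial.coeff_X_mul, Polynomial.coeff_eq_zero_of_natDegree_lt
      ((natDegree_markedProd_le B n 0 j).trans_lt n.lt_succ_self), mul_zero, zero_add]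

lemma coeff_self_markedProd (n : ℕ) :
    (markedProd B n 1 0).coeff n = 0 ∧
      (markedProd B n 1 1).coeff n = ∏ i ∈ Finset.range n, translateHom (i : K) (B 1 1) := by
  induction n with
  | zero => simp [markedProd_zero]
  | succ n ih =>
    rw [coeff_succ_markedProd_succ, coeff_succ_markedProd_succ, ih.1, ih.2,
      Finset.prod_range_succ, mul_comm]
    exact ⟨zero_mul _, mul_comm _ _⟩

lemma coeff_self_trace_markedProd (n : ℕ) :
    (markedProd B (n + 1)).trace.coeff (n + 1) =
      ∏ i ∈ Finset.range (n + 1), translateHom (i : K) (B 1 1) := by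
  rw [Matrix.trace_fin_two, Polynomial.coeff_add, (coeff_self_markedProd B (n + 1)).2,
    coeff_succ_markedProd_succ, (coeff_self_markedProd B n).1, mul_zero, zero_add]

lemma coeff_zero_markedProd {r : K} (hr : B 0 0 = .C r) (n : ℕ) :
    (markedProd B n 0 0).coeff 0 = .C (r ^ n) ∧ (markedProd B n 0 1).coeff 0 = 0 := by
  induction n with
  | zero => simp [markedProd_zero]
  | succ n ih =>
    simp [markedProd_succ, Polynomial.mul_coeff_zero, ih.1, ih.2, hr, translateHom_apply, pow_succ,
      mul_comm]

lemma coeff_zero_trace_markedProd {r : K} (hr : B 0 0 = .C r) (n : ℕ) :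
    (markedProd B (n + 1)).trace.coeff 0 = .C (r ^ (n + 1)) := by
  rw [Matrix.trace_fin_two, Polynomial.coeff_add, (coeff_zero_markedProd B hr (n + 1)).1,
    markedProd_succ]
  simp [Polynomial.mul_coeff_zero, (coeff_zero_markedProd B hr n).2]

lemma natDegree_trace_markedProd_le (n : ℕ) : (markedProd B n).trace.natDegree ≤ n := by
  rw [Matrix.trace_fin_two]
  exact Polynomial.natDegree_add_le_of_degree_le (natDegree_markedProd_le B n 0 0)
    (natDegree_markedProd_le B n 1 1)

lemma eval_one_trace_markedProd (n : ℕ) :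
    (markedProd B n).trace.eval 1 = (shiftProd (translateHom 1) B n).trace := by
  have hcomm : (Polynomial.evalRingHom (1 : K[X])).comp
      (Polynomial.mapRingHom (translateHom 1)) =
      (translateHom 1).comp (Polynomial.evalRingHom 1) := by
    ext <;> simp
  have hB : (Polynomial.evalRingHom (1 : K[X])).mapMatrix (markColumn B) = B := by
    ext1 i j
    fin_cases i <;> fin_cases j <;> simp [markColumn]
  have h := mapMatrix_shiftProd _ (markColumn B) _ _ hcomm n
  rw [hB] at h
  rw [← h]
  exact AddMonoidHom.map_trace (Polynomial.evalRingHom (1 : K[X])).toAddMonoidHom _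

lemma halfDegreeLE_C {P : K[X]} {d : ℕ} (hP : P.natDegree ≤ d) {e : ℤ} (he : 2 * d ≤ e) :
    HalfDegreeLE e (.C P) := by
  intro n k hk
  rw [Polynomial.coeff_C]
  split_ifs
  · exact Polynomial.coeff_eq_zero_of_natDegree_lt (by omega)
  · simp

lemma halfDegreeLE_X : HalfDegreeLE 0 (.X : K[X][X]) := by
  intro n k hk
  have hk0 : k ≠ 0 := by rintro rfl; simp at hk
  rw [Polynomial.coeff_X]
  split_ifs <;> simp [Polynomial.coeff_one, hk0]

lemma HalfDegreeLE.derivative {d : ℤ} {P : K[X][X]} (hP : HalfDegreeLE d P) :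
    HalfDegreeLE d (Polynomial.derivative P) := by
  intro n k hk
  have hcast : ((n : K[X]) + 1) = .C ((n : K) + 1) := by simp
  rw [Polynomial.coeff_derivative, hcast, Polynomial.coeff_mul_C, hP _ _ hk, zero_mul]

variable (a b c d e : K)

lemma halfDegreeLE_markColumn_reducedLax (i j : Fin 2) :
    HalfDegreeLE (3 + rowWeight i - rowWeight j) (markColumn (reducedLax a b c d e) i j) := by
  have h00 : (reducedLax a b c d e 0 0).natDegree ≤ 0 := (Polynomial.natDegree_C _).le
  have h01 : (reducedLax a b c d e 0 1).natDegree ≤ 1 := by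
    simp only [reducedLax, Matrix.cons_val', Matrix.of_apply, Matrix.cons_val]
    compute_degree
  have h10 : (reducedLax a b c d e 1 0).natDegree ≤ 2 := by
    simp only [reducedLax, Matrix.cons_val', Matrix.of_apply, Matrix.cons_val]
    compute_degree
  have h11 : (reducedLax a b c d e 1 1).natDegree ≤ 1 := by
    simp only [reducedLax, Matrix.cons_val', Matrix.of_apply, Matrix.cons_val]
    compute_degree
  fin_cases i <;> fin_cases j
  · exact halfDegreeLE_C h00 (by simp [rowWeight])
  · exact ((halfDegreeLE_C h01 le_rfl).mul halfDegreeLE_X).mono (by simp [rowWeight])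
  · exact halfDegreeLE_C h10 (by simp [rowWeight])
  · exact ((halfDegreeLE_C h11 le_rfl).mul halfDegreeLE_X).mono (by simp [rowWeight])

variable (p : ℕ) [Fact p.Prime] [CharP K p]

/-- Words using both columns contribute only in degree less than `p`. -/
lemma coeff_trace_markedProd_eq_zero (hp2 : p ≠ 2) {n k : ℕ} (hn : n ≠ 0) (hnp : n < p)
    (hk : p ≤ k) :
    ((markedProd (reducedLax a b c d e) p).trace.coeff n).coeff k = 0 := by
  have hp : 2 ≤ p := (Fact.out : p.Prime).two_le
  obtain ⟨m, rfl⟩ := Nat.exists_eq_succ_of_ne_zero hn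
  obtain ⟨q, hq⟩ : ∃ q, p = q + 1 := ⟨p - 1, by omega⟩
  let σ : K[X][X] →+* K[X][X] := Polynomial.mapRingHom (translateHom 1)
  let M := markColumn (reducedLax a b c d e)
  have hσ : σ ^ (q + 1) = 1 := by
    rw [mapRingHom_pow, ← hq, translateHom_one_pow_char]
    ext <;> simp
  have hD := derivative_trace_shiftProd σ M (fun x => by simp [σ, Polynomial.derivative_map]) hσ
  set W := (M.map Polynomial.derivative * σ.mapMatrix (shiftProd σ M q)).trace with hWdef
  have hW : HalfDegreeLE (3 * p) W := by
    have hM := halfDegreeLE_markColumn_reducedLax a b c d e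
    have hΦ := halfDegreeLE_shiftProd hM q
    have hterm : ∀ i j, HalfDegreeLE (3 * p)
        ((M.map Polynomial.derivative) i j * σ.mapMatrix (shiftProd σ M q) j i) := fun i j =>
      ((hM i j).derivative.mul ((hΦ j i).translateHom 1)).mono (by rw [hq]; push_cast; linarith)
    rw [hWdef, Matrix.trace_fin_two, Matrix.mul_apply, Matrix.mul_apply, Fin.sum_univ_two,
      Fin.sum_univ_two]
    exact ((hterm 0 0).add (hterm 0 1)).add ((hterm 1 0).add (hterm 1 1))
  have hc := congrArg (fun P : K[X][X] => (P.coeff m).coeff k) hD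
  simp only [Polynomial.coeff_derivative, Polynomial.finsetSum_coeff] at hc
  have hsum : ∑ i ∈ Finset.range (q + 1), (((σ ^ i) W).coeff m).coeff k = 0 := by
    have h0 := coeff_sum_translateHom_eq_zero p (W := W.coeff m)
      (fun k hk => hW m k (by omega)) hk
    rw [Polynomial.finsetSum_coeff] at h0
    rw [← hq, ← h0]
    refine Finset.sum_congr rfl fun i _ => ?_
    rw [mapRingHom_pow, translateHom_one_pow, Polynomial.coe_mapRingHom, Polynomial.coeff_map]
  have hcast : ((m : K[X]) + 1) = .C ((m : K) + 1) := by simp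
  rw [hsum, hcast, Polynomial.coeff_mul_C] at hc
  have hm : (m : K) + 1 ≠ 0 := by
    intro h
    have h' : ((m + 1 : ℕ) : K) = 0 := by push_cast; exact h
    rw [CharP.cast_eq_zero_iff K p] at h'
    exact absurd (Nat.le_of_dvd m.succ_pos h') (by omega)
  have hfin := (mul_eq_zero.mp hc).resolve_right hm
  rw [hq]
  exact hfin

lemma coeff_laxTrace (hp2 : p ≠ 2) {k : ℕ} (hk : p ≤ k) :
    (laxTrace p a b c d e).coeff k = if k = p then e ^ p else 0 := by
  have hp : 2 ≤ p := (Fact.out : p.Prime).two_le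
  obtain ⟨q, hq⟩ : ∃ q, p = q + 1 := ⟨p - 1, by omega⟩
  set T := (markedProd (reducedLax a b c d e) p).trace with hT
  have hsum : laxTrace p a b c d e = ∑ n ∈ Finset.range (p + 1), T.coeff n := by
    rw [laxTrace, ← eval_one_trace_markedProd, Polynomial.eval_eq_sum_range'
      (Nat.lt_succ_of_le (natDegree_trace_markedProd_le _ p))]
    simp [hT]
  have h0 : (T.coeff 0).coeff k = 0 := by
    rw [hT, hq, coeff_zero_trace_markedProd (r := b * (a * b - c)) _ (by simp [reducedLax])]
    exact Polynomial.coeff_C_of_ne_zero (by omega)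
  have hmid : ∀ n ∈ Finset.range p, (T.coeff n).coeff k = 0 := by
    intro n hn
    rcases eq_or_ne n 0 with rfl | hn0
    · exact h0
    · exact coeff_trace_markedProd_eq_zero a b c d e p hp2 hn0 (Finset.mem_range.mp hn) hk
  have htop : T.coeff p = ∏ i ∈ Finset.range p, translateHom (i : K) (reducedLax a b c d e 1 1) := by
    have h := coeff_self_trace_markedProd (reducedLax a b c d e) q
    rwa [← hq] at h
  have hfac : ∀ i : ℕ, translateHom (i : K) (reducedLax a b c d e 1 1) =
      .C e * .X + .C (e * i - e * (a * b) - a * (a * b + d)) := by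
    intro i
    simp [reducedLax, translateHom_apply]
    ring
  have hdeg : ∀ i ∈ Finset.range p,
      (translateHom (i : K) (reducedLax a b c d e 1 1)).natDegree ≤ 1 := fun i _ => by
    rw [hfac]
    exact Polynomial.natDegree_linear_le
  rw [hsum, Polynomial.finsetSum_coeff, Finset.sum_range_succ, Finset.sum_eq_zero hmid, zero_add,
    htop]
  split_ifs with hkp
  · have h := Polynomial.coeff_prod_of_natDegree_le _ _ 1 hdeg
    rw [Finset.card_range, mul_one] at h
    rw [hkp, h]
    simp [hfac]
  · refine Polynomial.coeff_eq_zero_of_natDegree_lt ?_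
    refine (Polynomial.natDegree_prod_le _ _).trans_lt ?_
    refine (Finset.sum_le_sum hdeg).trans_lt ?_
    simp
    omega

/-- The trace of the shifted product depends on the spectral variable only through
`e ^ p * (z ^ p - z)`. -/
lemma eval_laxTrace (hp2 : p ≠ 2) (z : K) :
    (laxTrace p a b c d e).eval z = (laxTrace p a b c d e).eval 0 + e ^ p * (z ^ p - z) := by
  have hp : 2 ≤ p := (Fact.out : p.Prime).two_le
  have hper : ∀ w, (laxTrace p a b c d e).eval (w + 1) = (laxTrace p a b c d e).eval w := by
    intro w
    obtain ⟨q, hq⟩ : ∃ q, p = q + 1 := ⟨p - 1, by omega⟩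
    have h := map_trace_shiftProd (translateHom 1) (reducedLax a b c d e) (n := q)
      (by rw [← hq]; exact translateHom_one_pow_char p)
    rw [← hq, ← laxTrace, translateHom_apply] at h
    rw [← Polynomial.taylor_eval, h]
  have hnat : ∀ n : ℕ, (laxTrace p a b c d e).eval (n : K) = (laxTrace p a b c d e).eval 0 := by
    intro n
    induction n with
    | zero => simp
    | succ n ih => rw [Nat.cast_succ, hper, ih]
  let J : K[X] := laxTrace p a b c d e - .C (e ^ p) * (.X ^ p - .X) -
    .C ((laxTrace p a b c d e).eval 0)
  have hJ : J = 0 := by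
    refine Polynomial.eq_zero_of_natDegree_lt_card_of_eval_eq_zero J
      (f := fun i : Fin p => ((i : ℕ) : K)) ?_ ?_ ?_
    · intro i j hij
      exact Fin.ext (CharP.natCast_injOn_Iio K p i.2 j.2 hij)
    · intro i
      have hfrob : ((i : ℕ) : K) ^ p = (i : ℕ) := by
        have : ExpChar K p := ExpChar.prime Fact.out
        exact map_natCast (frobenius K p) i
      simp [J, hnat, hfrob]
    · rw [Fintype.card_fin]
      refine Nat.lt_of_le_pred (by omega) (Polynomial.natDegree_le_iff_coeff_eq_zero.mpr
        fun k hk' => ?_)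
      have hk : p ≤ k := by rw [Nat.pred_eq_sub_one] at hk'; omega
      have hk1 : 1 ≠ k := by omega
      have hk0 : k ≠ 0 := by omega
      simp only [J, Polynomial.coeff_sub, Polynomial.coeff_C_mul, coeff_laxTrace a b c d e p hp2 hk,
        Polynomial.coeff_X_pow, Polynomial.coeff_X, Polynomial.coeff_C, if_neg hk1, if_neg hk0]
      split_ifs <;> simp
  have hz := congrArg (Polynomial.eval z) hJ
  simp only [J, Polynomial.eval_sub, Polynomial.eval_mul, Polynomial.eval_C, Polynomial.eval_pow,
    Polynomial.eval_X, Polynomial.eval_zero] at hz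
  linear_combination hz

end LaxTrace

lemma evalP_Ip (p : ℕ) (K : Type*) [Field K] [CharP K p] (a b c d e : K) :
    evalP p (Ip p) K a b c d e = (laxTrace p a b c d e).eval 0 := by
  let φ : R p →+* K := eval₂Hom (ZMod.castHom (dvd_refl p) K) ![a, b, c, d, e]
  have hA : ∀ k : ℕ, φ.mapMatrix (AM p (RingHom.id (R p)) (k : R p)) =
      (Polynomial.evalRingHom (k : K)).mapMatrix (laxPoly a b c d e) := by
    intro k
    ext1 i j
    fin_cases i <;> fin_cases j <;>
      simp [AM, A0, A1, A2, A3, hP, fP, gP, a1P, a2P, tP, laxPoly, φ] <;> ring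
  have hprod : ∀ n : ℕ, φ.mapMatrix
      (((List.range n).reverse.map (fun k : ℕ => AM p (RingHom.id (R p)) (k : R p))).prod) =
      (Polynomial.evalRingHom (0 : K)).mapMatrix
        (shiftProd (translateHom 1) (laxPoly a b c d e) n) := by
    intro n
    induction n with
    | zero => simp [shiftProd]
    | succ n ih =>
      rw [List.range_succ, List.reverse_append, List.reverse_singleton, List.singleton_append,
        List.map_cons, List.prod_cons, map_mul, ih, hA, shiftProd, map_mul]
      congr 1
      rw [translateHom_one_pow]
      ext1 i j
      simp [translateHom_apply, Polynomial.taylor_eval]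
  have hI : Ip p = (((List.range p).reverse.map
      (fun k : ℕ => AM p (RingHom.id (R p)) (k : R p))).prod).trace := by
    simp [Ip, ← List.map_eq_flatMap, Function.comp_def]
  calc evalP p (Ip p) K a b c d e
      = (φ.mapMatrix
          (((List.range p).reverse.map (fun k : ℕ => AM p (RingHom.id (R p)) (k : R p))).prod)).trace :=
        by rw [hI]; exact AddMonoidHom.map_trace φ.toAddMonoidHom _
    _ = (shiftProd (translateHom 1) (laxPoly a b c d e) p).trace.eval 0 := by
        rw [hprod]
        exact (AddMonoidHom.map_trace (Polynomial.evalRingHom (0 : K)).toAddMonoidHom _).symm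
    _ = (laxTrace p a b c d e).eval 0 := by rw [trace_laxPoly]

/-- For odd primes `p`, both the Weyl group generator `s₂` and the
rotation `π` map the integral of motion `I_p` to `I_p − t^p·(α₂^p − α₂)`. -/
theorem Ip_s2_pi_action (p : ℕ) (hp : p.Prime) (hodd : p ≠ 2) (K : Type*) [Field K]
    [CharP K p] (a b c d e : K) :
    (b ≠ 0 →
      evalP p (Ip p) K (a + d / b) b (c + d) (-d) e
      = evalP p (Ip p) K a b c d e - e ^ p * (d ^ p - d)) ∧
    (evalP p (Ip p) K (-b) (a - b + e) d (1 - c - d) e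
      = evalP p (Ip p) K a b c d e - e ^ p * (d ^ p - d)) := by
  have : Fact p.Prime := ⟨hp⟩
  have key : ∀ a₁ b₁ c₁ d₁ : K,
      translateHom d (laxTrace p a₁ b₁ c₁ d₁ e) = laxTrace p a b c d e →
      evalP p (Ip p) K a₁ b₁ c₁ d₁ e = evalP p (Ip p) K a b c d e - e ^ p * (d ^ p - d) := by
    intro a₁ b₁ c₁ d₁ h
    rw [evalP_Ip, evalP_Ip, ← h, translateHom_apply, Polynomial.taylor_eval, zero_add,
      eval_laxTrace a₁ b₁ c₁ d₁ e p hodd d]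
    ring
  exact ⟨fun hb => key _ _ _ _ (translateHom_laxTrace_reflection p a b c d e hb),
    key _ _ _ _ (translateHom_laxTrace_rotation p a b c d e)⟩
end

section
/- Let p be a prime, let S = 𝔽_p[x, y, α₁, α₂, t] be the polynomial ring in four further indeterminates together with α₁, α₂, t, and let L be its field of fractions. Then the element of L obtained by evaluating the polynomial I_p at (f, g, α₁, α₂, t) = (x⁻¹, (x·(1 − t·x + (t² + 1 − α₁ − α₂)·x² + y·x³))⁻¹, α₁, α₂, t) can be written as N/D with polynomials N, D ∈ S such that x does not divide D; equivalently, this element lies in the localization of S at the prime ideal generated by x. (The integral of motion I_p extends regularly across the exceptional curve E₈ of the space of initial values away from the anticanonical divisor.) -/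
open MvPolynomial

section PrimeDenominators

variable {S L : Type*} [CommRing S] [Field L] [Algebra S L] [IsFractionRing S L]

/-- The elements of a fraction field of `S` having a denominator prime to the prime element
`π`, i.e. the localization of `S` at `(π)`. -/
def regularSubring (L : Type*) [Field L] [Algebra S L] [IsFractionRing S L] {π : S}
    (hπ : Prime π) : Subring L where
  carrier := {a | ∃ N D : S, ¬ π ∣ D ∧ a = algebraMap S L N / algebraMap S L D}
  one_mem' := ⟨1, 1, hπ.not_dvd_one, by simp⟩
  zero_mem' := ⟨0, 1, hπ.not_dvd_one, by simp⟩
  mul_mem' := by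
    rintro _ _ ⟨N, D, hD, rfl⟩ ⟨N₁, D₁, hD₁, rfl⟩
    exact ⟨N * N₁, D * D₁, hπ.not_dvd_mul hD hD₁, by simp [div_mul_div_comm]⟩
  add_mem' := by
    rintro _ _ ⟨N, D, hD, rfl⟩ ⟨N₁, D₁, hD₁, rfl⟩
    have hne {E : S} (hE : ¬ π ∣ E) : algebraMap S L E ≠ 0 := fun h =>
      hE (((IsFractionRing.to_map_eq_zero_iff).mp h) ▸ dvd_zero π)
    exact ⟨N * D₁ + D * N₁, D * D₁, hπ.not_dvd_mul hD hD₁, by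
      simp [div_add_div _ _ (hne hD) (hne hD₁)]⟩
  neg_mem' := by
    rintro _ ⟨N, D, hD, rfl⟩
    exact ⟨-N, D, hD, by simp [neg_div]⟩

variable {π : S} (hπ : Prime π)

lemma algebraMap_mem_regularSubring (a : S) : algebraMap S L a ∈ regularSubring L hπ :=
  ⟨a, 1, hπ.not_dvd_one, by simp⟩

lemma inv_algebraMap_mem_regularSubring {a : S} (ha : ¬ π ∣ a) :
    (algebraMap S L a)⁻¹ ∈ regularSubring L hπ :=
  ⟨1, a, ha, by simp⟩

end PrimeDenominators

lemma Subring.list_prod_matrix_apply_mem {A n : Type*} [CommRing A] [Fintype n] [DecidableEq n]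
    (O : Subring A) (l : List (Matrix n n A)) (hl : ∀ M ∈ l, ∀ i j, M i j ∈ O) (i j : n) :
    l.prod i j ∈ O := by
  have : l.prod ∈ O.matrix := list_prod_mem fun M hM => hl M hM
  exact this i j

/-- Gauge transformations telescope along the product `A (n-1) ⋯ A 1 A 0`. -/
lemma gauge_mul_list_prod {M : Type*} [Monoid M] (T A B : ℕ → M)
    (h : ∀ k, T (k + 1) * A k = B k * T k) (n : ℕ) :
    T n * ((List.range n).reverse.map A).prod = ((List.range n).reverse.map B).prod * T 0 := by
  induction n with
  | zero => simp
  | succ n ih =>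
    simp only [List.range_succ, List.reverse_append, List.reverse_singleton, List.map_append,
      List.map_cons, List.map_nil, List.prod_append, List.prod_singleton]
    rw [← mul_assoc, h, mul_assoc, ih, mul_assoc]

lemma trace_eq_of_mul_eq_mul {n K : Type*} [Fintype n] [DecidableEq n] [Field K]
    {T P Q : Matrix n n K} (hT : T.det ≠ 0) (h : T * P = Q * T) : P.trace = Q.trace := by
  have hu : IsUnit T.det := isUnit_iff_ne_zero.mpr hT
  have hQ : Q = T * P * T⁻¹ := by rw [h, Matrix.mul_nonsing_inv_cancel_right _ _ hu]
  rw [hQ, Matrix.trace_mul_comm, Matrix.nonsing_inv_mul_cancel_left _ _ hu]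

section Gauge

variable {K : Type*} [Field K]

/-- The Lax matrix of the fourth Painlevé equation, written out. -/
def laxMatrix (f g a b t z : K) : Matrix (Fin 2) (Fin 2) K :=
  let h := f * g * (t * g - 1) * (t * f - 1) + a * (t * g - 1) - b * (t * f - 1)
  !![t * z ^ 2 - a * g + f * g ^ 2 - t * f ^ 2 * g ^ 2, z - f * g;
     f * g * h - a * b + h * z + (1 - t ^ 2 * f * g) * z ^ 2 - t ^ 2 * z ^ 3,
     -t * z ^ 2 - b * f - f ^ 2 * g + t * f ^ 2 * g ^ 2]

lemma det_laxMatrix (f g a b t z : K) :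
    (laxMatrix f g a b t z).det = -(z * (z - a) * (z + b)) := by
  simp only [laxMatrix, Matrix.det_fin_two_of]
  ring

/-- The lower left entry of the gauge transformation removing the pole along `x = 0`. -/
def gaugeShift (x g a t z : K) : K := t * (z + x⁻¹ * g) - g - (z - a) * x

/-- The gauge transformation removing the pole of the Lax matrix along `x = 0`. -/
def gaugeMatrix (x g a t z : K) : Matrix (Fin 2) (Fin 2) K :=
  !![x ^ 2, 0; gaugeShift x g a t z, 1]

/-- The lower right entry of the gauge transformed Lax matrix, where `w` is the inverse of
`1 + x * v` and `v = -t + e * x + y * x ^ 2`. -/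
def gaugedCorner (x y a b t w z : K) : K :=
  let e := t ^ 2 + 1 - a - b
  let v := -t + e * x + y * x ^ 2
  t * z - (z + 1 - a) * x * z
    + w ^ 2 * (-b * (2 * v + x * v ^ 2) - y - t * e - t * y * x + (1 - a) * v)

variable {x y a b t w z : K}

/-- A gauge transform of the Lax matrix, whose entries are regular along `x = 0`. -/
def gaugedMatrix (x y a b t w z : K) : Matrix (Fin 2) (Fin 2) K :=
  let u := 1 - t * x + (t ^ 2 + 1 - a - b) * x ^ 2 + y * x ^ 3
  !![x * z * (z - a), x ^ 2 * z - w;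
     -(u * (x * z * (z - a) * gaugedCorner x y a b t w z + z * (z - a) * (z + b)))
        * (1 - u * x ^ 2 * z)⁻¹,
     gaugedCorner x y a b t w z]

lemma gaugeShift_mul_add (hx : x ≠ 0)
    (hw : w * (1 - t * x + (t ^ 2 + 1 - a - b) * x ^ 2 + y * x ^ 3) = 1) :
    gaugeShift x (x⁻¹ * w) a t (z + 1) * (z - x⁻¹ * (x⁻¹ * w)) - t * z ^ 2 - b * x⁻¹
      - x⁻¹ ^ 2 * (x⁻¹ * w) + t * x⁻¹ ^ 2 * (x⁻¹ * w) ^ 2 = gaugedCorner x y a b t w z := by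
  have hw0 : w ≠ 0 := left_ne_zero_of_mul_eq_one hw
  have hy : y = (w⁻¹ - (1 - t * x + (t ^ 2 + 1 - a - b) * x ^ 2)) / x ^ 3 := by
    field_simp
    linear_combination hw
  rw [hy]
  simp only [gaugedCorner, gaugeShift]
  field_simp
  ring

lemma gaugeMatrix_mul_laxMatrix (hx : x ≠ 0)
    (hw : w * (1 - t * x + (t ^ 2 + 1 - a - b) * x ^ 2 + y * x ^ 3) = 1)
    (hz : 1 - (1 - t * x + (t ^ 2 + 1 - a - b) * x ^ 2 + y * x ^ 3) * x ^ 2 * z ≠ 0) :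
    gaugeMatrix x (x⁻¹ * w) a t (z + 1) * laxMatrix x⁻¹ (x⁻¹ * w) a b t z
      = gaugedMatrix x y a b t w z * gaugeMatrix x (x⁻¹ * w) a t z := by
  have hw0 : w ≠ 0 := left_ne_zero_of_mul_eq_one hw
  have hcorner := gaugeShift_mul_add (z := z) hx hw
  have hdet := det_laxMatrix x⁻¹ (x⁻¹ * w) a b t z
  have hcol : laxMatrix x⁻¹ (x⁻¹ * w) a b t z 0 0
      - laxMatrix x⁻¹ (x⁻¹ * w) a b t z 0 1 * gaugeShift x (x⁻¹ * w) a t z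
      = x * z * (z - a) := by
    simp only [laxMatrix, gaugeShift, Matrix.of_apply, Matrix.cons_val]
    field_simp
    ring
  have hupper : x ^ 2 * laxMatrix x⁻¹ (x⁻¹ * w) a b t z 0 1 = x ^ 2 * z - w := by
    simp only [laxMatrix, Matrix.of_apply, Matrix.cons_val]
    field_simp
  have hrow : gaugeShift x (x⁻¹ * w) a t (z + 1) * laxMatrix x⁻¹ (x⁻¹ * w) a b t z 0 1
      + laxMatrix x⁻¹ (x⁻¹ * w) a b t z 1 1 = gaugedCorner x y a b t w z := by
    rw [← hcorner]
    simp only [laxMatrix, Matrix.of_apply, Matrix.cons_val]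
    ring
  rw [Matrix.det_fin_two] at hdet
  simp only [gaugedMatrix, gaugeMatrix]
  generalize laxMatrix x⁻¹ (x⁻¹ * w) a b t z = A at *
  generalize gaugeShift x (x⁻¹ * w) a t (z + 1) = s₁ at *
  generalize gaugeShift x (x⁻¹ * w) a t z = s at *
  generalize gaugedCorner x y a b t w z = c at *
  generalize 1 - t * x + (t ^ 2 + 1 - a - b) * x ^ 2 + y * x ^ 3 = u at *
  have hunit : x ^ 2 * A 0 1 = -w * (1 - u * x ^ 2 * z) := by
    linear_combination hupper - x ^ 2 * z * hw
  have hne : A 0 1 ≠ 0 := right_ne_zero_of_mul (hunit ▸ mul_ne_zero (neg_ne_zero.mpr hw0) hz)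
  have hlower : s₁ * A 0 0 + A 1 0
      = -(u * (x * z * (z - a) * c + z * (z - a) * (z + b))) * (1 - u * x ^ 2 * z)⁻¹ * x ^ 2
        + c * s := by
    apply mul_right_cancel₀ hne
    have hinv : (1 - u * x ^ 2 * z)⁻¹ * (1 - u * x ^ 2 * z) = 1 := inv_mul_cancel₀ hz
    generalize (1 - u * x ^ 2 * z)⁻¹ = r at *
    linear_combination A 0 0 * hrow + c * hcol - hdet
      + (u * (x * z * (z - a) * c + z * (z - a) * (z + b))) * r * hunit
      - (x * z * (z - a) * c + z * (z - a) * (z + b)) * (w * u * hinv + hw)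
  rw [Matrix.eta_fin_two A, Matrix.mul_fin_two, Matrix.mul_fin_two, ← hlower]
  ext i j
  fin_cases i <;> fin_cases j <;> simp
  · linear_combination x ^ 2 * hcol + s * hupper
  · exact hupper
  · exact hrow

lemma gaugedMatrix_apply_mem {O : Subring K} (hx : x ∈ O) (hy : y ∈ O) (ha : a ∈ O) (hb : b ∈ O)
    (ht : t ∈ O) (hw : w ∈ O) (hz : z ∈ O)
    (hinv : (1 - (1 - t * x + (t ^ 2 + 1 - a - b) * x ^ 2 + y * x ^ 3) * x ^ 2 * z)⁻¹ ∈ O)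
    (i j : Fin 2) : gaugedMatrix x y a b t w z i j ∈ O := by
  simp only [gaugedMatrix, gaugedCorner]
  generalize (1 - (1 - t * x + (t ^ 2 + 1 - a - b) * x ^ 2 + y * x ^ 3) * x ^ 2 * z)⁻¹ = r at *
  revert i j
  simp only [Fin.forall_fin_two, Matrix.of_apply, Matrix.cons_val]
  refine ⟨⟨?_, ?_⟩, ?_, ?_⟩ <;>
    repeat' first
      | assumption
      | exact one_mem O
      | exact ofNat_mem O 2
      | apply add_mem
      | apply sub_mem
      | apply mul_mem
      | apply neg_mem
      | apply pow_mem

end Gauge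

lemma det_gaugeMatrix {K : Type*} [Field K] (x g a t z : K) :
    (gaugeMatrix x g a t z).det = x ^ 2 := by
  simp [gaugeMatrix, Matrix.det_fin_two_of]

lemma AM_eq_laxMatrix (p : ℕ) {K : Type*} [Field K] (φ : R p →+* K) (z : K) :
    AM p φ z = laxMatrix (φ (X 0)) (φ (X 1)) (φ (X 2)) (φ (X 3)) (φ (X 4)) z := by
  ext i j
  fin_cases i <;> fin_cases j <;>
    simp [AM, A0, A1, A2, A3, laxMatrix, hP, fP, gP, a1P, a2P, tP] <;> ring

lemma map_Ip (p : ℕ) {K : Type*} [CommRing K] (φ : R p →+* K) :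
    φ (Ip p) = (((List.range p).reverse.map (fun k : ℕ => AM p φ (k : K))).prod).trace := by
  have hcast : ((List.range p).reverse >>= fun k => pure (k : R p))
      = (List.range p).reverse.map (fun k : ℕ => (k : R p)) :=
    List.flatMap_pure_eq_map _ _
  rw [Ip, hcast, AddMonoidHom.map_trace φ, ← RingHom.mapMatrix_apply, map_list_prod,
    List.map_map, List.map_map]
  congr 3
  funext k
  ext i j
  simp [AM]

/-- With `S = 𝔽_p[x, y, α₁, α₂, t]` (here realised as `R` with `x, y`
playing the roles of the first two indeterminates) and `L = Frac(S)`, the evaluation of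
`I_p` at `(f, g) = (x⁻¹, (x·(1 − t·x + (t² + 1 − α₁ − α₂)·x² + y·x³))⁻¹)` can be written
as `N/D` with `N, D ∈ S` and `x ∤ D`: the integral of motion extends regularly across the
exceptional curve `E₈` of the space of initial values. -/
theorem Ip_regular_on_E8 (p : ℕ) [Fact p.Prime] :
    ∃ N D : R p, ¬ ((X 0 : R p) ∣ D) ∧
      eval₂ ((algebraMap (R p) (FractionRing (R p))).comp (C : ZMod p →+* R p))
        ![(algebraMap (R p) (FractionRing (R p)) (X 0))⁻¹,
          (algebraMap (R p) (FractionRing (R p))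
            (X 0 * (1 - X 4 * X 0 + (X 4 ^ 2 + 1 - X 2 - X 3) * X 0 ^ 2 + X 1 * X 0 ^ 3)))⁻¹,
          algebraMap (R p) (FractionRing (R p)) (X 2),
          algebraMap (R p) (FractionRing (R p)) (X 3),
          algebraMap (R p) (FractionRing (R p)) (X 4)] (Ip p)
      = algebraMap (R p) (FractionRing (R p)) N / algebraMap (R p) (FractionRing (R p)) D := by
  have hπ : Prime (X 0 : R p) := X_prime
  have hnd (c : R p) : ¬ (X 0 : R p) ∣ 1 + X 0 * c := fun h =>
    hπ.not_dvd_one ((dvd_add_left (dvd_mul_right _ c)).mp h)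
  set ι := algebraMap (R p) (FractionRing (R p))
  have hne {D : R p} (hD : ¬ (X 0 : R p) ∣ D) : ι D ≠ 0 := fun h =>
    hD (IsFractionRing.to_map_eq_zero_iff.mp h ▸ dvd_zero _)
  have hx : ι (X 0) ≠ 0 := fun h => hπ.ne_zero (IsFractionRing.to_map_eq_zero_iff.mp h)
  set u : R p := 1 - X 4 * X 0 + (X 4 ^ 2 + 1 - X 2 - X 3) * X 0 ^ 2 + X 1 * X 0 ^ 3 with hu
  have hund : ¬ (X 0 : R p) ∣ u := by
    rw [show u = 1 + X 0 * (-X 4 + (X 4 ^ 2 + 1 - X 2 - X 3) * X 0 + X 1 * X 0 ^ 2) by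
      rw [hu]; ring]
    exact hnd _
  have hιu : ι u = 1 - ι (X 4) * ι (X 0) + (ι (X 4) ^ 2 + 1 - ι (X 2) - ι (X 3)) * ι (X 0) ^ 2
      + ι (X 1) * ι (X 0) ^ 3 := by
    simp [hu]
  have hznd (k : ℕ) : ¬ (X 0 : R p) ∣ 1 - u * X 0 ^ 2 * (k : R p) := by
    rw [show 1 - u * X 0 ^ 2 * (k : R p) = 1 + X 0 * -(u * X 0 * (k : R p)) by ring]
    exact hnd _
  have hιz (k : ℕ) : ι (1 - u * X 0 ^ 2 * (k : R p)) = 1 - ι u * ι (X 0) ^ 2 * k := by simp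
  rw [map_mul, mul_inv]
  let φ : R p →+* FractionRing (R p) := eval₂Hom (ι.comp C)
    ![(ι (X 0))⁻¹, (ι (X 0))⁻¹ * (ι u)⁻¹, ι (X 2), ι (X 3), ι (X 4)]
  let B (k : ℕ) := gaugedMatrix (ι (X 0)) (ι (X 1)) (ι (X 2)) (ι (X 3)) (ι (X 4)) (ι u)⁻¹
    (k : FractionRing (R p))
  let T (k : ℕ) := gaugeMatrix (ι (X 0)) ((ι (X 0))⁻¹ * (ι u)⁻¹) (ι (X 2)) (ι (X 4))
    (k : FractionRing (R p))
  have hgauge (k : ℕ) : T (k + 1) * AM p φ (k : FractionRing (R p)) = B k * T k := by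
    have := gaugeMatrix_mul_laxMatrix (y := ι (X 1)) (z := (k : FractionRing (R p))) hx
      (by rw [← hιu]; exact inv_mul_cancel₀ (hne hund))
      (by rw [← hιu, ← hιz]; exact hne (hznd k))
    rw [AM_eq_laxMatrix]
    simpa [T, B, φ] using this
  have htel := gauge_mul_list_prod T (fun k => AM p φ (k : FractionRing (R p))) B hgauge p
  have : CharP (FractionRing (R p)) p := charP_of_injective_algebraMap
    (IsFractionRing.injective (R p) (FractionRing (R p))) p
  have hT : T p = T 0 := by simp [T]
  rw [hT] at htel
  have htrace := trace_eq_of_mul_eq_mul (by simp [T, det_gaugeMatrix, hx]) htel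
  change φ (Ip p) ∈ regularSubring (FractionRing (R p)) hπ
  rw [map_Ip, htrace]
  refine sum_mem fun i _ => Subring.list_prod_matrix_apply_mem _ _ ?_ i i
  simp only [List.mem_map, forall_exists_index, and_imp]
  rintro _ k - rfl
  have hmem := algebraMap_mem_regularSubring (L := FractionRing (R p)) hπ
  exact gaugedMatrix_apply_mem (hmem _) (hmem _) (hmem _) (hmem _) (hmem _)
    (inv_algebraMap_mem_regularSubring hπ hund) (natCast_mem _ k) (by
      rw [← hιu, ← hιz]
      exact inv_algebraMap_mem_regularSubring hπ (hznd k))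
end
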